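/- Let φ, φ' : S¹ → S² be continuous injective maps with sup_{z ∈ S¹} dist(φ(z), φ'(z)) < ε for some ε > 0. Suppose the complement S² \ image(φ) has exactly two connected components U₀ and U₁, and suppose p₀ ∈ U₀ and p₁ ∈ U₁ are points whose open ε-balls satisfy B(p₀, ε) ⊆ U₀ and B(p₁, ε) ⊆ U₁. Then p₀ and p₁ lie in different connected components of S² \ image(φ'). -/

import Mathlib

open Metric

noncomputable section

/-- The Euclidean 3-space. -/
abbrev E3 : Type := EuclideanSpace ℝ (Fin 3)

/-- The unit 2-sphere in `ℝ³`. -/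
abbrev Sph : Type := Metric.sphere (0 : E3) 1

/-- The unit circle in `ℂ`. -/
abbrev Circ : Type := Metric.sphere (0 : ℂ) 1

/-- A nonvanishing function on the circle has a continuous logarithm. -/
def HasLog (f : Circ → ℂ) : Prop := ∃ L : Circ → ℂ, Continuous L ∧ ∀ z, Complex.exp (L z) = f z

theorem HasLog.of_close {f g : Circ → ℂ} (hf : HasLog f) (hg : Continuous g)
    (h : ∀ z, ‖g z - f z‖ < ‖f z‖) : HasLog g := by
  obtain ⟨L, hL, hLf⟩ := hf
  have hf0 : ∀ z, f z ≠ 0 := fun z => by rw [← hLf z]; exact Complex.exp_ne_zero _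
  have hfc : Continuous f := by
    have : f = fun z => Complex.exp (L z) := by ext z; rw [hLf]
    rw [this]; fun_prop
  have hq : ∀ z, ‖g z / f z - 1‖ < 1 := fun z => by
    have h1 : g z / f z - 1 = (g z - f z) / f z := by field_simp [hf0 z]
    rw [h1, norm_div, div_lt_one (norm_pos_iff.2 (hf0 z))]
    exact h z
  have hs : ∀ z, g z / f z ∈ Complex.slitPlane := fun z => by
    have := Complex.mem_slitPlane_of_norm_lt_one (hq z)
    simpa using this
  refine ⟨fun z => L z + Complex.log (g z / f z), ?_, fun z => ?_⟩
  · exact hL.add (Continuous.clog (hg.div hfc hf0) hs)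
  · rw [Complex.exp_add, hLf, Complex.exp_log (Complex.slitPlane_ne_zero (hs z))]
    field_simp [hf0 z]

instance : CompactSpace Circ := isCompact_iff_compactSpace.1 (isCompact_sphere _ _)

theorem hasLog_loc {T : Type*} [TopologicalSpace T] (f : T → Circ → ℂ)
    (hf : Continuous (fun p : T × Circ => f p.1 p.2)) (h0 : ∀ t z, f t z ≠ 0) (t : T) :
    ∀ᶠ s in nhds t, (HasLog (f s) ↔ HasLog (f t)) := by
  have hc : ∀ s, Continuous (f s) := fun s => hf.comp (Continuous.prodMk_right s)
  have h1 : ∀ᶠ s in nhds t, ∀ z ∈ (Set.univ : Set Circ), ‖f s z - f t z‖ < ‖f t z‖ ∧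
      ‖f t z - f s z‖ < ‖f s z‖ := by
    apply isCompact_univ.eventually_forall_of_forall_eventually
    intro z _
    have hft : Continuous (fun p : T × Circ => f t p.2) := (hc t).comp continuous_snd
    have hpos : 0 < ‖f t z‖ := norm_pos_iff.2 (h0 t z)
    apply Filter.Eventually.and
    · apply ContinuousAt.eventually_lt (by fun_prop) (by fun_prop)
      simpa using h0 t z
    · apply ContinuousAt.eventually_lt (by fun_prop) (by fun_prop)
      simpa using h0 t z
  filter_upwards [h1] with s hs
  exact ⟨fun h => h.of_close (hc t) fun z => (hs z trivial).2,
    fun h => h.of_close (hc s) fun z => (hs z trivial).1⟩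

theorem hasLog_iff {T : Type*} [TopologicalSpace T] [PreconnectedSpace T] (f : T → Circ → ℂ)
    (hf : Continuous (fun p : T × Circ => f p.1 p.2)) (h0 : ∀ t z, f t z ≠ 0) (s t : T) :
    HasLog (f s) ↔ HasLog (f t) := by
  have : IsLocallyConstant (fun t => HasLog (f t)) := by
    rw [IsLocallyConstant.iff_eventually_eq]
    intro t
    filter_upwards [hasLog_loc f hf h0 t] with s hs
    exact propext hs
  exact iff_of_eq (this.apply_eq_of_preconnectedSpace s t)

theorem hasLog_const {c : ℂ} (hc : c ≠ 0) : HasLog (fun _ => c) :=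
  ⟨fun _ => Complex.log c, continuous_const, fun _ => Complex.exp_log hc⟩

instance : ConnectedSpace Circ :=
  isConnected_iff_connectedSpace.1 (isConnected_sphere (by simp [Complex.rank_real_complex]) 0 zero_le_one)

theorem not_hasLog_id {R : ℂ} (hR : R ≠ 0) : ¬ HasLog (fun z : Circ => R * (z : ℂ)) := by
  rintro ⟨L, hL, hexp⟩
  have hg : Continuous (fun z : Circ => (L z - L (-z)).im) := by fun_prop
  have hz : ∃ z : Circ, (L z - L (-z)).im = 0 := by
    let z₀ : Circ := ⟨1, by simp⟩
    by_cases h : (L z₀ - L (-z₀)).im ≤ 0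
    · refine mem_range_of_exists_le_of_exists_ge hg ⟨z₀, h⟩ ⟨-z₀, ?_⟩
      simp at h ⊢; linarith
    · refine mem_range_of_exists_le_of_exists_ge hg ⟨-z₀, ?_⟩ ⟨z₀, ?_⟩
      all_goals simp at h ⊢; linarith
  obtain ⟨z, hz⟩ := hz
  have hz0 : (z : ℂ) ≠ 0 := by
    intro h
    have := z.2
    rw [mem_sphere, h] at this
    simp at this
  have h1 : Complex.exp (L z - L (-z)) = -1 := by
    rw [Complex.exp_sub, hexp, hexp]
    have : ((-z : Circ) : ℂ) = -(z : ℂ) := rfl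
    simp only [this]; field_simp
  have h2 := congrArg Complex.re h1
  rw [Complex.exp_re, hz] at h2
  simp at h2
  linarith [Real.exp_pos ((L z).re - (L (-z)).re)]

open Classical in
theorem not_hasLog_of_sep (f : Circ → ℂ) (hf : Continuous f) (hi : Function.Injective f)
    (U : Set ℂ) (hb : Bornology.IsBounded U) (hfr : frontier U ⊆ Set.range f)
    (w₀ : ℂ) (hw : w₀ ∈ U) : ¬ HasLog (fun z => f z - w₀) := by
  rintro ⟨L, hL, hexp⟩
  obtain ⟨G, hG⟩ := ContinuousMap.exists_extension' (hf.isClosedEmbedding hi) (⟨L, hL⟩ : C(Circ, ℂ))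
  have hG' : ∀ z, G (f z) = L z := fun z => congrFun hG z
  let F : ℂ → ℂ := U.piecewise (fun w => Complex.exp (G w)) (fun w => w - w₀)
  have hF : Continuous F := by
    apply Continuous.piecewise
    · intro a ha
      obtain ⟨z, rfl⟩ := hfr ha
      rw [hG', hexp]
    · fun_prop
    · fun_prop
  have hF0 : ∀ w, F w ≠ 0 := by
    intro w
    by_cases h : w ∈ U
    · simp only [F, Set.piecewise_eq_of_mem _ _ _ h]; exact Complex.exp_ne_zero _
    · simp only [F, Set.piecewise_eq_of_notMem _ _ _ h]
      intro h'
      rw [sub_eq_zero] at h'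
      exact h (h' ▸ hw)
  obtain ⟨R, hR⟩ := hb.subset_ball w₀
  have hRpos : 0 < R := by
    have := hR hw
    simpa using this
  have key := hasLog_iff (T := ℝ) (fun t z => F (w₀ + t * z)) (by fun_prop) (fun _ _ => hF0 _) 0 R
  have h1 : HasLog (fun z : Circ => F (w₀ + (R : ℝ) * z)) := key.1 (by
    simpa using hasLog_const (hF0 w₀))
  apply not_hasLog_id (R := (R : ℂ)) (by exact_mod_cast hRpos.ne')
  convert h1 using 2 with z
  have hn : w₀ + R * (z : ℂ) ∉ U := by
    intro h
    have := hR h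
    have hz : ‖(z : ℂ)‖ = 1 := by simpa using z.2
    simp [hz, abs_of_pos hRpos] at this
  simp [F, Set.piecewise_eq_of_notMem _ _ _ hn]

theorem seg_ne (a b p : E3) (ha : ‖a‖ = 1) (hb : ‖b‖ = 1) (hp : ‖p‖ = 1)
    (h : ‖a - b‖ < ‖a - p‖) (t : ℝ) (ht0 : 0 ≤ t) (ht1 : t ≤ 1) (r : ℝ) (hr : 0 ≤ r) :
    (1 - t) • a + t • b ≠ r • p := by
  intro heq
  set m := inner ℝ a b with hm
  set q := inner ℝ a p with hq
  have e1 : ‖a - b‖ ^ 2 = 2 - 2 * m := by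
    rw [norm_sub_sq_real, ha, hb]; ring
  have e2 : ‖a - p‖ ^ 2 = 2 - 2 * q := by
    rw [norm_sub_sq_real, ha, hp]; ring
  have hqm : q < m := by
    have : ‖a - b‖ ^ 2 < ‖a - p‖ ^ 2 := by gcongr
    linarith
  have hm1 : |m| ≤ 1 := by
    have := abs_real_inner_le_norm a b
    rwa [ha, hb, one_mul] at this
  have hq1 : |q| ≤ 1 := by
    have := abs_real_inner_le_norm a p
    rwa [ha, hp, one_mul] at this
  rw [abs_le] at hm1 hq1
  have e3 : (1 - t) + t * m = r * q := by
    have := congrArg (fun v => inner ℝ a v) heq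
    simp only [inner_add_right, inner_smul_right, real_inner_self_eq_norm_sq, ha] at this
    rw [← hm, ← hq] at this
    linarith
  have e4 : (1 - t) ^ 2 + 2 * (1 - t) * t * m + t ^ 2 = r ^ 2 := by
    have := congrArg (fun v => ‖v‖ ^ 2) heq
    simp only [norm_add_sq_real, inner_smul_left, inner_smul_right, norm_smul, ha, hb, hp, mul_pow,
      Real.norm_eq_abs, sq_abs] at this
    rw [← hm] at this
    simp at this
    linarith
  have hr1 : r ≤ 1 := by
    have : r ^ 2 ≤ 1 := by nlinarith [mul_nonneg (sub_nonneg.2 ht1) ht0]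
    nlinarith
  have hr2 : |2 * t - 1| ≤ r := by
    apply abs_le_of_sq_le_sq _ hr
    nlinarith [mul_nonneg (sub_nonneg.2 ht1) ht0]
  rw [abs_le] at hr2
  rcases hr.eq_or_lt with h0 | h0
  · subst h0
    have : t = 1 / 2 := by linarith
    subst this
    linarith
  · have h3 : 1 - t < (r - t) * m := by nlinarith
    by_cases h4 : 0 ≤ m
    · nlinarith
    · nlinarith

theorem exists_chart (p : Sph) : ∃ (e : Sph → ℂ) (σ : ℂ → Sph), Continuous σ ∧
    ContinuousOn e {p}ᶜ ∧ (∀ w, σ w ≠ p) ∧ (∀ w, e (σ w) = w) ∧ ∀ x, x ≠ p → σ (e x) = x := by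
  haveI : Fact (Module.finrank ℝ E3 = 2 + 1) := ⟨by simp⟩
  let c := stereographic' 2 p
  let i : EuclideanSpace ℝ (Fin 2) ≃ₗᵢ[ℝ] ℂ := Complex.orthonormalBasisOneI.repr.symm
  have hs : c.source = {p}ᶜ := stereographic'_source p
  have ht : c.target = Set.univ := stereographic'_target p
  refine ⟨fun x => i (c x), fun w => c.symm (i.symm w), ?_, ?_, ?_, ?_, ?_⟩
  · have : Continuous c.symm := by
      rw [← continuousOn_univ, ← ht]; exact c.continuousOn_symm
    exact this.comp i.symm.continuous
  · rw [← hs]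
    exact i.continuous.comp_continuousOn c.continuousOn
  · intro w
    have : c.symm (i.symm w) ∈ c.source := c.map_target (by rw [ht]; trivial)
    rw [hs] at this
    exact this
  · intro w
    have h := c.right_inv (x := i.symm w) (by rw [ht]; trivial)
    simp only [h, LinearIsometryEquiv.apply_symm_apply]
  · intro x hx
    simp only [LinearIsometryEquiv.symm_apply_apply]
    exact c.left_inv (by rw [hs]; exact hx)

theorem sph_locConn : LocallyConnectedSpace Sph := by
  haveI : Fact (Module.finrank ℝ E3 = 2 + 1) := ⟨by simp⟩
  exact ChartedSpace.locallyConnectedSpace (EuclideanSpace ℝ (Fin 2)) Sph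

instance : CompactSpace Sph := isCompact_iff_compactSpace.1 (isCompact_sphere _ _)

theorem exists_homotopy (φ φ' : Circ → Sph) (hφ : Continuous φ) (hφ' : Continuous φ')
    (p₀ p₁ : Sph) (h0 : ∀ z, dist (φ z) (φ' z) < dist (φ z) p₀)
    (h1 : ∀ z, dist (φ z) (φ' z) < dist (φ z) p₁) :
    ∃ H : unitInterval → Circ → Sph, Continuous (fun q : unitInterval × Circ => H q.1 q.2) ∧
      (∀ z, H 0 z = φ z) ∧ (∀ z, H 1 z = φ' z) ∧ ∀ t z, H t z ≠ p₀ ∧ H t z ≠ p₁ := by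
  have nrm : ∀ x : Sph, ‖(x : E3)‖ = 1 := fun x => by simpa using x.2
  let v : unitInterval → Circ → E3 := fun t z => (1 - (t : ℝ)) • (φ z : E3) + (t : ℝ) • (φ' z : E3)
  have hv : ∀ p : Sph, (∀ z, dist (φ z) (φ' z) < dist (φ z) p) → ∀ t z, ∀ r : ℝ, 0 ≤ r →
      v t z ≠ r • (p : E3) := by
    intro p hp t z r hr
    refine seg_ne _ _ _ (nrm _) (nrm _) (nrm _) ?_ t t.2.1 t.2.2 r hr
    have := hp z
    rwa [Subtype.dist_eq, Subtype.dist_eq, dist_eq_norm, dist_eq_norm] at this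
  have hv0 : ∀ t z, v t z ≠ 0 := fun t z => by simpa using hv p₀ h0 t z 0 le_rfl
  have hvc : Continuous (fun q : unitInterval × Circ => v q.1 q.2) := by
    simp only [v]; fun_prop
  refine ⟨fun t z => ⟨‖v t z‖⁻¹ • v t z, ?_⟩, ?_, ?_, ?_, ?_⟩
  · simp [norm_smul, inv_mul_cancel₀ (norm_ne_zero_iff.2 (hv0 t z))]
  · apply Continuous.subtype_mk
    exact (hvc.norm.inv₀ fun q => norm_ne_zero_iff.2 (hv0 _ _)).smul hvc
  · intro z
    apply Subtype.ext
    simp [v, nrm]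
  · intro z
    apply Subtype.ext
    simp [v, nrm]
  · have aux : ∀ p : Sph, (∀ z, dist (φ z) (φ' z) < dist (φ z) p) → ∀ t z,
        ‖v t z‖⁻¹ • v t z ≠ (p : E3) := by
      intro p hp t z h
      apply hv p hp t z ‖v t z‖ (norm_nonneg _)
      rw [← h, smul_smul, mul_inv_cancel₀ (norm_ne_zero_iff.2 (hv0 t z)), one_smul]
    exact fun t z => ⟨fun h => aux p₀ h0 t z (congrArg Subtype.val h),
      fun h => aux p₁ h1 t z (congrArg Subtype.val h)⟩

theorem hasLog_of_same (φ : Circ → Sph) (hφ : Continuous φ) (p₀ p₁ : Sph)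
    (e : Sph → ℂ) (σ : ℂ → Sph) (hσ : Continuous σ) (he : ContinuousOn e {p₁}ᶜ)
    (hσp : ∀ w, σ w ≠ p₁) (hσe : ∀ x, x ≠ p₁ → σ (e x) = x)
    (h01 : p₀ ≠ p₁) (h1 : p₁ ∉ Set.range φ)
    (C : Set Sph) (hC : IsPreconnected C) (hCφ : C ⊆ (Set.range φ)ᶜ) (h0C : p₀ ∈ C)
    (h1C : p₁ ∈ C) : HasLog (fun z => e (φ z) - e p₀) := by
  have hne : ∀ z, φ z ≠ p₁ := fun z h => h1 ⟨z, h⟩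
  have hf : Continuous (fun z => e (φ z)) := he.comp_continuous hφ hne
  let P : Sph → Prop := fun s => s = p₁ ∨ HasLog (fun z => e (φ z) - e s)
  have hP : ∀ s ∉ Set.range φ, ∀ᶠ s' in nhds s, (P s' ↔ P s) := by
    intro s hs
    by_cases hsp : s = p₁
    · subst hsp
      obtain ⟨M, hM⟩ := (isCompact_range hf).isBounded.subset_closedBall 0
      have hcl : IsClosed (σ '' closedBall 0 M) :=
        ((isCompact_closedBall (0 : ℂ) M).image hσ).isClosed
      have : (σ '' closedBall 0 M)ᶜ ∈ nhds s := hcl.isOpen_compl.mem_nhds (by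
        rintro ⟨w, _, hw⟩
        exact hσp w hw)
      filter_upwards [this] with s' hs'
      refine iff_of_true ?_ (Or.inl rfl)
      by_cases hss : s' = s
      · exact Or.inl hss
      · right
        have hlt : M < ‖e s'‖ := by
          by_contra hcon
          exact hs' ⟨e s', by simpa using hcon, hσe s' hss⟩
        have hle : ∀ z, ‖e (φ z)‖ ≤ M := fun z => by
          simpa using hM ⟨z, rfl⟩
        have hM0 : 0 ≤ M := (norm_nonneg _).trans (hle ⟨1, by simp⟩)
        have hes : -e s' ≠ 0 := by
          rw [neg_ne_zero, ← norm_pos_iff]; linarith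
        apply (hasLog_const hes).of_close (g := fun z => e (φ z) - e s') (hf.sub continuous_const)
        intro z
        simp only [sub_neg_eq_add, sub_add_cancel, norm_neg]
        exact (hle z).trans_lt hlt
    · let O : Set Sph := {p₁}ᶜ ∩ (Set.range φ)ᶜ
      have hO : IsOpen O := isOpen_compl_singleton.inter
        (isCompact_range hφ).isClosed.isOpen_compl
      have heO : Continuous (fun x : O => e x) :=
        he.comp_continuous continuous_subtype_val (fun x => x.2.1)
      have := hasLog_loc (T := O) (fun s z => e (φ z) - e s)
        ((hf.comp continuous_snd).sub (heO.comp continuous_fst)) (by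
          intro t z h
          rw [sub_eq_zero] at h
          have h2 := congrArg σ h
          rw [hσe _ (hne z), hσe _ t.2.1] at h2
          exact t.2.2 ⟨z, h2⟩) ⟨s, hsp, hs⟩
      have h2 : ∀ᶠ s' in nhds s, s' ∈ O := hO.mem_nhds ⟨hsp, hs⟩
      rw [← map_nhds_subtype_coe_eq_nhds (p := fun x => x ∈ O) ⟨hsp, hs⟩ h2,
        Filter.eventually_map]
      filter_upwards [this] with s' hs'
      have h3 : (s' : Sph) ≠ p₁ := s'.2.1
      simp only [P, hsp, h3, false_or]
      exact hs'
  haveI : PreconnectedSpace C := isPreconnected_iff_preconnectedSpace.1 hC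
  have hlc : IsLocallyConstant (fun t : C => P t) := by
    rw [IsLocallyConstant.iff_eventually_eq]
    intro t
    filter_upwards [continuous_subtype_val.continuousAt.eventually (hP t (hCφ t.2))] with s hs
    exact propext hs
  have h := hlc.apply_eq_of_preconnectedSpace ⟨p₀, h0C⟩ ⟨p₁, h1C⟩
  have h' : P p₀ := by
    have h2 : P p₀ = P p₁ := h
    rw [h2]; exact Or.inl rfl
  exact h'.resolve_left h01

/-- If `φ, φ'` are simple closed curves in the sphere at sup distance less than `ε`, the
complement of `φ` has exactly two connected components `U₀, U₁`, and `p₀ ∈ U₀`, `p₁ ∈ U₁`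
have their open `ε`-balls contained in `U₀` resp. `U₁`, then `p₀` and `p₁` lie in different
connected components of the complement of `φ'`. -/
theorem separated_components_of_close_curves
    (φ φ' : Circ → Sph)
    (hφc : Continuous φ) (hφi : Function.Injective φ)
    (hφ'c : Continuous φ') (hφ'i : Function.Injective φ')
    (ε : ℝ) (hε : 0 < ε) (hclose : ∀ z : Circ, dist (φ z) (φ' z) < ε)
    (U₀ U₁ : Set Sph) (hne : U₀ ≠ U₁)
    (hcover : (Set.range φ)ᶜ = U₀ ∪ U₁)
    (hU₀ : ∃ a ∈ (Set.range φ)ᶜ, U₀ = connectedComponentIn (Set.range φ)ᶜ a)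
    (hU₁ : ∃ a ∈ (Set.range φ)ᶜ, U₁ = connectedComponentIn (Set.range φ)ᶜ a)
    (p₀ p₁ : Sph) (hp₀ : p₀ ∈ U₀) (hp₁ : p₁ ∈ U₁)
    (hball₀ : Metric.ball p₀ ε ⊆ U₀) (hball₁ : Metric.ball p₁ ε ⊆ U₁) :
    p₀ ∈ (Set.range φ')ᶜ ∧ p₁ ∈ (Set.range φ')ᶜ ∧
      connectedComponentIn (Set.range φ')ᶜ p₀ ≠ connectedComponentIn (Set.range φ')ᶜ p₁ := by
  haveI := sph_locConn
  have hK : IsOpen (Set.range φ)ᶜ := (isCompact_range hφc).isClosed.isOpen_compl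
  have hd : ∀ p U, Metric.ball p ε ⊆ U → U ⊆ (Set.range φ)ᶜ → ∀ z,
      dist (φ z) (φ' z) < dist (φ z) p := by
    intro p U hb hU z
    by_contra hcon
    have : φ z ∈ Metric.ball p ε := by
      rw [mem_ball]
      exact (not_lt.1 hcon).trans_lt (hclose z)
    exact hU (hb this) ⟨z, rfl⟩
  have hd0 := hd p₀ U₀ hball₀ (hcover ▸ Set.subset_union_left)
  have hd1 := hd p₁ U₁ hball₁ (hcover ▸ Set.subset_union_right)
  have hp0' : p₀ ∈ (Set.range φ')ᶜ := by
    rintro ⟨z, rfl⟩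
    exact lt_irrefl _ (hd0 z)
  have hp1' : p₁ ∈ (Set.range φ')ᶜ := by
    rintro ⟨z, rfl⟩
    exact lt_irrefl _ (hd1 z)
  have hp1 : p₁ ∉ Set.range φ := by
    have : p₁ ∈ (Set.range φ)ᶜ := by rw [hcover]; exact Or.inr hp₁
    exact this
  refine ⟨hp0', hp1', fun heq => ?_⟩
  obtain ⟨a₀, ha₀, rfl⟩ := hU₀
  obtain ⟨a₁, ha₁, rfl⟩ := hU₁
  set K := (Set.range φ)ᶜ with hKdef
  have ho0 : IsOpen (connectedComponentIn K a₀) := hK.connectedComponentIn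
  have ho1 : IsOpen (connectedComponentIn K a₁) := hK.connectedComponentIn
  have hdisj : Disjoint (connectedComponentIn K a₀) (connectedComponentIn K a₁) := by
    rw [Set.disjoint_left]
    intro x hx0 hx1
    exact hne ((connectedComponentIn_eq hx0).trans (connectedComponentIn_eq hx1).symm)
  have h01 : p₀ ≠ p₁ := by
    rintro rfl
    exact Set.disjoint_left.1 hdisj hp₀ hp₁
  obtain ⟨e, σ, hσ, he, hσp, heσ, hσe⟩ := exists_chart p₁
  have hne1 : ∀ z, φ z ≠ p₁ := fun z h => hp1 ⟨z, h⟩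
  have hf : Continuous (fun z => e (φ z)) := he.comp_continuous hφc hne1
  -- no logarithm for the first curve
  have hA : ¬ HasLog (fun z => e (φ z) - e p₀) := by
    apply not_hasLog_of_sep (fun z => e (φ z)) hf ?_ (σ ⁻¹' connectedComponentIn K a₀)
    · have hc : IsCompact (connectedComponentIn K a₁)ᶜ := ho1.isClosed_compl.isCompact
      have hc2 : IsCompact (e '' (connectedComponentIn K a₁)ᶜ) :=
        hc.image_of_continuousOn (he.mono (by
          rintro x hx rfl
          exact hx hp₁))
      refine hc2.isBounded.subset ?_
      intro w hw
      exact ⟨σ w, fun h => Set.disjoint_left.1 hdisj hw h, heσ w⟩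
    · intro w hw
      have hU : IsOpen (σ ⁻¹' connectedComponentIn K a₀) := ho0.preimage hσ
      rw [hU.frontier_eq] at hw
      by_contra hcon
      have hK' : σ w ∈ K := by
        rintro ⟨z, hz⟩
        exact hcon ⟨z, by simp only [hz, heσ]⟩
      rw [hcover] at hK'
      rcases hK' with h | h
      · exact hw.2 h
      · obtain ⟨x, hx1, hx0⟩ := mem_closure_iff.1 hw.1 _ (ho1.preimage hσ) h
        exact Set.disjoint_left.1 hdisj hx0 hx1
    · simpa [hσe p₀ h01] using hp₀
    · intro z z' h
      have h2 := congrArg σ h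
      simp only [hσe _ (hne1 _)] at h2
      exact hφi h2
  obtain ⟨H, hHc, hH0, hH1, hHp⟩ := exists_homotopy φ φ' hφc hφ'c p₀ p₁ hd0 hd1
  have hB := hasLog_iff (fun t z => e (H t z) - e p₀)
    ((he.comp_continuous hHc (fun q => (hHp q.1 q.2).2)).sub continuous_const) (by
      intro t z h
      rw [sub_eq_zero] at h
      have h2 := congrArg σ h
      rw [hσe _ (hHp t z).2, hσe _ h01] at h2
      exact (hHp t z).1 h2) 0 1
  simp only [hH0, hH1] at hB
  apply hA
  rw [hB]
  exact hasLog_of_same φ' hφ'c p₀ p₁ e σ hσ he hσp hσe h01 hp1' _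
    isPreconnected_connectedComponentIn (connectedComponentIn_subset _ p₀)
    (mem_connectedComponentIn hp0') (heq ▸ mem_connectedComponentIn hp1')
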